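/- Let (D₁, D₂, D₃, c, g₁, g₂, g₃, ξ) be a BKL datum satisfying the BKL constraints that is in normal form with parameter u, and suppose u > 1 and u ≠ 2 at every point of ℝ³. Define g₂³ = −c_{12}^1 − D₂(ξ), g₃⁴ = −c_{31}^1 + D₃(ξ), and û = u − 1, a smooth positive function. Then the triple of vector fields D̂₁ = (u/(u−1)) D₃, D̂₂ = (u/(u−1)) D₂, D̂₃ = (u/(u−1)) (D₁ − (2 g₃⁴/(u−2)) D₂ + (2 u g₂³/(2u−1)) D₃) is a frame, and (D̂₁, D̂₂, D̂₃, ĉ, 1/2, −(1+û)/2, −(1+1/û)/2, ξ + log(u/(u−1))), with ĉ its structure functions, is a BKL datum satisfying the BKL constraints. -/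

import Mathlib

noncomputable section

/-- Points of `ℝ³`. -/
abbrev R3 : Type := Fin 3 → ℝ

/-- Lie bracket of vector fields on `ℝ³`:
`[X,Y](x) = (DY)_x(X(x)) − (DX)_x(Y(x))`. -/
def lieB (X Y : R3 → R3) : R3 → R3 :=
  fun x => fderiv ℝ Y x (X x) - fderiv ℝ X x (Y x)

/-- Directional derivative `X(f)(x) = (Df)_x(X(x))`. -/
def dirD (X : R3 → R3) (f : R3 → ℝ) : R3 → ℝ :=
  fun x => fderiv ℝ f x (X x)

/-- A frame: three smooth vector fields, linearly independent at every point. -/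
def IsFrame (D : Fin 3 → R3 → R3) : Prop :=
  (∀ i, ContDiff ℝ (⊤ : ℕ∞) (D i)) ∧ ∀ x : R3, LinearIndependent ℝ fun i => D i x

/-- `c` is the family of (smooth) structure functions of the frame `D`:
`[D j, D k] = ∑ i, c j k i • D i`.  Here `c j k i` stands for `c_{jk}^i`. -/
def IsStructFns (D : Fin 3 → R3 → R3) (c : Fin 3 → Fin 3 → Fin 3 → R3 → ℝ) : Prop :=
  (∀ j k i, ContDiff ℝ (⊤ : ℕ∞) (c j k i)) ∧
    ∀ j k, ∀ x : R3, lieB (D j) (D k) x = ∑ i, c j k i x • D i x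

/-- `(i,j,k)` is a cyclic permutation of `(1,2,3)` (as indices `(0,1,2)`). -/
def Cyclic (i j k : Fin 3) : Prop :=
  (i, j, k) = (0, 1, 2) ∨ (i, j, k) = (1, 2, 0) ∨ (i, j, k) = (2, 0, 1)

/-- The BKL constraint equations for the datum `(D, c, g, ξ)`. -/
def BKLConstraints (D : Fin 3 → R3 → R3) (c : Fin 3 → Fin 3 → Fin 3 → R3 → ℝ)
    (g : Fin 3 → R3 → ℝ) (ξ : R3 → ℝ) : Prop :=
  (∀ x : R3, g 1 x * g 2 x + g 2 x * g 0 x + g 0 x * g 1 x = 0) ∧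
    ∀ i j k : Fin 3, Cyclic i j k → ∀ x : R3,
      dirD (D i) (fun y => g j y + g k y) x + c i j j x * (g i x - g j x)
        + c i k k x * (g i x - g k x) - 2 * dirD (D i) ξ x * g i x = 0

/-- Smoothness of the functions in a BKL datum. -/
def SmoothDatum (g : Fin 3 → R3 → ℝ) (ξ : R3 → ℝ) : Prop :=
  (∀ i, ContDiff ℝ (⊤ : ℕ∞) (g i)) ∧ ContDiff ℝ (⊤ : ℕ∞) ξ

/-- `B^f = exp (f · log B)`. -/
def bpow (B f : R3 → ℝ) : R3 → ℝ := fun x => Real.exp (f x * Real.log (B x))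

/-- The transformed frame `D̂ i = σ A B^(g j + g k) • D i`, `(i,j,k)` cyclic. -/
def confFrame (D : Fin 3 → R3 → R3) (g : Fin 3 → R3 → ℝ) (A B : R3 → ℝ) (σ : ℝ) :
    Fin 3 → R3 → R3 :=
  fun i x => (σ * A x * bpow B (fun y => g (i + 1) y + g (i + 2) y) x) • D i x


/-- `g₂³ = −c_{12}^1 − D₂(ξ)` (indices `1,2,3` are `0,1,2`). -/
def g23fn (D : Fin 3 → R3 → R3) (c : Fin 3 → Fin 3 → Fin 3 → R3 → ℝ) (ξ : R3 → ℝ) :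
    R3 → ℝ :=
  fun x => -c 0 1 0 x - dirD (D 1) ξ x

/-- `g₃⁴ = −c_{31}^1 + D₃(ξ)`. -/
def g34fn (D : Fin 3 → R3 → R3) (c : Fin 3 → Fin 3 → Fin 3 → R3 → ℝ) (ξ : R3 → ℝ) :
    R3 → ℝ :=
  fun x => -c 2 0 0 x + dirD (D 2) ξ x

/-- `D̃₁ = D₁ − (2 g₃⁴/(u−2)) D₂ + (2 u g₂³/(2u−1)) D₃`. -/
def tiltedD1 (D : Fin 3 → R3 → R3) (c : Fin 3 → Fin 3 → Fin 3 → R3 → ℝ)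
    (ξ u : R3 → ℝ) : R3 → R3 :=
  fun x => D 0 x - (2 * g34fn D c ξ x / (u x - 2)) • D 1 x
    + (2 * u x * g23fn D c ξ x / (2 * u x - 1)) • D 2 x

/-- Normal form: `(g₁,g₂,g₃) = (1/2, −(1+u)/2, −(1+1/u)/2)` and `c_{23}^1 = −2`. -/
def IsNormalForm (c : Fin 3 → Fin 3 → Fin 3 → R3 → ℝ)
    (g : Fin 3 → R3 → ℝ) (u : R3 → ℝ) : Prop :=
  ContDiff ℝ (⊤ : ℕ∞) u ∧ (∀ x : R3, 0 < u x) ∧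
    (∀ x : R3, g 0 x = 1 / 2) ∧ (∀ x : R3, g 1 x = -(1 + u x) / 2) ∧
    (∀ x : R3, g 2 x = -(1 + 1 / u x) / 2) ∧ ∀ x : R3, c 1 2 0 x = -2

open VectorField

lemma ContDiff.dirD {X : R3 → R3} {f : R3 → ℝ} (hX : ContDiff ℝ (⊤ : ℕ∞) X)
    (hf : ContDiff ℝ (⊤ : ℕ∞) f) : ContDiff ℝ (⊤ : ℕ∞) (dirD X f) :=
  (hf.fderiv_right (by simp)).clm_apply hX

lemma dirD_comp (X : R3 → R3) {f : R3 → ℝ} (hf : ContDiff ℝ (⊤ : ℕ∞) f) {φ : ℝ → ℝ} {φ' : ℝ}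
    {x : R3} (h : HasDerivAt φ φ' (f x)) : dirD X (fun y => φ (f y)) x = φ' * dirD X f x := by
  have h' := h.comp_hasFDerivAt x (hf.differentiable (by simp) x).hasFDerivAt
  change fderiv ℝ (φ ∘ f) x (X x) = _
  rw [h'.fderiv]
  simp [dirD]

lemma dirD_add (X : R3 → R3) {f g : R3 → ℝ} (hf : ContDiff ℝ (⊤ : ℕ∞) f)
    (hg : ContDiff ℝ (⊤ : ℕ∞) g) (x : R3) :
    dirD X (fun y => f y + g y) x = dirD X f x + dirD X g x := by
  simp [dirD, fderiv_fun_add (hf.differentiable (by simp) x) (hg.differentiable (by simp) x)]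

lemma dirD_mul (X : R3 → R3) {f g : R3 → ℝ} (hf : ContDiff ℝ (⊤ : ℕ∞) f)
    (hg : ContDiff ℝ (⊤ : ℕ∞) g) (x : R3) :
    dirD X (fun y => f y * g y) x = f x * dirD X g x + g x * dirD X f x := by
  simp [dirD, fderiv_fun_mul (hf.differentiable (by simp) x) (hg.differentiable (by simp) x)]

lemma dirD_const (X : R3 → R3) (r : ℝ) (x : R3) : dirD X (fun _ => r) x = 0 := by
  simp [dirD]

lemma dirD_neg (X : R3 → R3) (f : R3 → ℝ) (x : R3) :
    dirD X (fun y => -f y) x = -dirD X f x := by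
  simp [dirD]

lemma dirD_field_smul_add (X Y Z : R3 → R3) (a b f : R3 → ℝ) (x : R3) :
    dirD (fun y => X y + a y • Y y + b y • Z y) f x =
      dirD X f x + a x * dirD Y f x + b x * dirD Z f x := by
  simp [dirD]

lemma two_le_smooth : minSmoothness ℝ 2 ≤ ((⊤ : ℕ∞) : WithTop ℕ∞) := by
  rw [minSmoothness_of_isRCLikeNormedField]
  exact WithTop.coe_le_coe.2 (le_top : (2 : ℕ∞) ≤ ⊤)

lemma dirD_smul (X : R3 → R3) (l f : R3 → ℝ) (x : R3) :
    dirD (fun y => l y • X y) f x = l x * dirD X f x := by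
  simp [dirD]

lemma sum_smul_tilt (D : Fin 3 → R3 → R3) (a b : R3 → ℝ) (v : Fin 3 → ℝ) (x : R3) :
    ∑ i, v i • D i x = ∑ i, ![v 2 - b x * v 0, v 1 - a x * v 0, v 0] i •
      ![D 2, D 1, fun x => D 0 x + a x • D 1 x + b x • D 2 x] i x := by
  simp only [Fin.sum_univ_three, Matrix.cons_val]
  module

namespace IsFrame

variable {D : Fin 3 → R3 → R3}

lemma coeff_ext (hD : IsFrame D) {x : R3} {a b : Fin 3 → ℝ}
    (h : ∑ i, a i • D i x = ∑ i, b i • D i x) (i : Fin 3) : a i = b i := by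
  have h' : ∑ i, (a i - b i) • D i x = 0 := by
    simp only [sub_smul, Finset.sum_sub_distrib, h, sub_self]
  exact sub_eq_zero.1 (Fintype.linearIndependent_iff.1 (hD.2 x) _ h' i)

lemma smul (hD : IsFrame D) {l : R3 → ℝ} (hl : ContDiff ℝ (⊤ : ℕ∞) l) (h0 : ∀ x, l x ≠ 0) :
    IsFrame fun i x => l x • D i x := by
  refine ⟨fun i => hl.smul (hD.1 i), fun x => Fintype.linearIndependent_iff.2 fun a ha i => ?_⟩
  have := Fintype.linearIndependent_iff.1 (hD.2 x) (fun i => a i * l x)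
    (by simpa only [smul_smul] using ha) i
  simpa [h0 x] using this

/-- The frame `(D₃, D₂, D₁ + a D₂ + b D₃)`. -/
lemma tilt (hD : IsFrame D) {a b : R3 → ℝ} (ha : ContDiff ℝ (⊤ : ℕ∞) a)
    (hb : ContDiff ℝ (⊤ : ℕ∞) b) :
    IsFrame ![D 2, D 1, fun x => D 0 x + a x • D 1 x + b x • D 2 x] := by
  constructor
  · intro i
    fin_cases i
    · exact hD.1 2
    · exact hD.1 1
    · exact ((hD.1 0).add (ha.smul (hD.1 1))).add (hb.smul (hD.1 2))
  · intro x
    refine Fintype.linearIndependent_iff.2 fun t ht => ?_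
    have key := Fintype.linearIndependent_iff.1 (hD.2 x)
      ![t 2, t 1 + t 2 * a x, t 0 + t 2 * b x] (by
        rw [← ht]
        simp only [Fin.sum_univ_three, Matrix.cons_val]
        module)
    have h0 := key 0
    have h1 := key 1
    have h2 := key 2
    simp only [Matrix.cons_val] at h0 h1 h2
    simp only [h0, zero_mul, add_zero] at h1 h2
    intro i
    fin_cases i <;> assumption

end IsFrame

namespace IsStructFns

variable {D : Fin 3 → R3 → R3} {c : Fin 3 → Fin 3 → Fin 3 → R3 → ℝ}

lemma swap (hc : IsStructFns D c) (hD : IsFrame D) (j k i : Fin 3) (x : R3) :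
    c j k i x = -c k j i x := by
  refine hD.coeff_ext (x := x) (a := fun i => c j k i x) (b := fun i => -c k j i x) ?_ i
  simp only [neg_smul, Finset.sum_neg_distrib]
  rw [← hc.2 j k x, ← hc.2 k j x]
  exact lieBracket_swap

lemma self (hc : IsStructFns D c) (hD : IsFrame D) (j i : Fin 3) (x : R3) :
    c j j i x = 0 := by
  linarith [hc.swap hD j j i x]

lemma lieB_sum_smul (hc : IsStructFns D c) (hD : IsFrame D) {f : Fin 3 → R3 → ℝ}
    (hf : ∀ i, ContDiff ℝ (⊤ : ℕ∞) (f i)) (j : Fin 3) (x : R3) :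
    lieB (D j) (fun y => ∑ i, f i y • D i y) x =
      ∑ i, (dirD (D j) (f i) x + ∑ m, f m x * c j m i x) • D i x := by
  have hfd : ∀ i, DifferentiableAt ℝ (f i) x := fun i => (hf i).differentiable (by simp) x
  have hDd : ∀ i, DifferentiableAt ℝ (D i) x := fun i => (hD.1 i).differentiable (by simp) x
  have hfDd : ∀ i, DifferentiableAt ℝ (fun y => f i y • D i y) x := fun i => (hfd i).smul (hDd i)
  have hfun : (fun y => ∑ i, f i y • D i y) =
      (fun y => f 0 y • D 0 y) + (fun y => f 1 y • D 1 y) + fun y => f 2 y • D 2 y := by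
    funext y
    simp [Fin.sum_univ_three]
  have h := fun i => lieBracket_smul_right (V := D j) (hfd i) (hDd i)
  have hb : ∀ m, lieBracket ℝ (D j) (D m) x = ∑ i, c j m i x • D i x := fun m => hc.2 j m x
  change lieBracket ℝ (D j) _ x = _
  rw [hfun, lieBracket_add_right ((hfDd 0).add (hfDd 1)) (hfDd 2),
    lieBracket_add_right (hfDd 0) (hfDd 1), h, h, h, hb, hb, hb]
  simp only [Fin.sum_univ_three, dirD]
  module

/-- The Jacobi identity in terms of the structure functions. -/
lemma jacobi (hc : IsStructFns D c) (hD : IsFrame D) (j k l i : Fin 3) (x : R3) :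
    dirD (D j) (c k l i) x + ∑ m, c k l m x * c j m i x =
      (dirD (D k) (c j l i) x + ∑ m, c j l m x * c k m i x)
        - (dirD (D l) (c j k i) x + ∑ m, c j k m x * c l m i x) := by
  have hb : ∀ j k l, lieBracket ℝ (D j) (lieBracket ℝ (D k) (D l)) x =
      ∑ i, (dirD (D j) (c k l i) x + ∑ m, c k l m x * c j m i x) • D i x := fun j k l => by
    rw [show lieBracket ℝ (D k) (D l) = _ from funext (hc.2 k l)]
    exact hc.lieB_sum_smul hD (hc.1 k l) j x
  have hs : ∀ i, ContDiffAt ℝ (⊤ : ℕ∞) (D i) x := fun i => (hD.1 i).contDiffAt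
  have h := leibniz_identity_lieBracket two_le_smooth (hs j) (hs k) (hs l)
  rw [lieBracket_swap (V := lieBracket ℝ (D j) (D k)), hb, hb, hb] at h
  refine hD.coeff_ext (x := x)
    (a := fun i => dirD (D j) (c k l i) x + ∑ m, c k l m x * c j m i x)
    (b := fun i => (dirD (D k) (c j l i) x + ∑ m, c j l m x * c k m i x)
        - (dirD (D l) (c j k i) x + ∑ m, c j k m x * c l m i x)) ?_ i
  simp only [sub_smul, Finset.sum_sub_distrib]
  rw [h]
  abel

lemma dirD_comm (hc : IsStructFns D c) (hD : IsFrame D) {f : R3 → ℝ}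
    (hf : ContDiff ℝ (⊤ : ℕ∞) f) (j k : Fin 3) (x : R3) :
    dirD (D j) (dirD (D k) f) x - dirD (D k) (dirD (D j) f) x =
      ∑ i, c j k i x * dirD (D i) f x := by
  have h := fderiv_apply_lieBracket (x := x) hf.contDiffAt two_le_smooth
    ((hD.1 k).differentiable (by simp) x) ((hD.1 j).differentiable (by simp) x)
  rw [show lieBracket ℝ (D j) (D k) x = _ from hc.2 j k x, map_sum] at h
  simp only [map_smul, smul_eq_mul] at h
  exact h.symm

/-- Structure functions of a rescaled frame. -/
lemma smul_eq {l : R3 → ℝ} (hc : IsStructFns (fun i x => l x • D i x) c) (hD : IsFrame D)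
    (hl : ContDiff ℝ (⊤ : ℕ∞) l) {x : R3} (h0 : l x ≠ 0) {e : Fin 3 → ℝ} {j k : Fin 3}
    (he : lieB (D j) (D k) x = ∑ i, e i • D i x) (i : Fin 3) :
    c j k i x = l x * e i + (if i = k then dirD (D j) l x else 0)
      - (if i = j then dirD (D k) l x else 0) := by
  have hDd : ∀ i, DifferentiableAt ℝ (D i) x := fun i => (hD.1 i).differentiable (by simp) x
  have hld : DifferentiableAt ℝ l x := hl.differentiable (by simp) x
  have h := hc.2 j k x
  change lieBracket ℝ (fun y => l y • D j y) (fun y => l y • D k y) x = _ at h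
  rw [lieBracket_smul_left hld (hDd j), lieBracket_smul_right hld (hDd k),
    show lieBracket ℝ (D j) (D k) x = _ from he] at h
  refine mul_right_cancel₀ h0 (hD.coeff_ext (x := x) (a := fun i => c j k i x * l x)
    (b := fun i => (l x * e i + (if i = k then dirD (D j) l x else 0)
      - (if i = j then dirD (D k) l x else 0)) * l x) ?_ i)
  simp only [mul_smul, ← h, sub_smul, add_smul, ite_smul, zero_smul, Finset.sum_sub_distrib,
    Finset.sum_add_distrib, Finset.sum_ite_eq', Finset.mem_univ, if_true, Finset.smul_sum, dirD,
    map_smul, smul_eq_mul]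
  simp only [Fin.sum_univ_three]
  module

end IsStructFns

/-- the bounce map, case `u > 1`, `u ≠ 2`. -/
theorem bkl_bounce_high
    (D : Fin 3 → R3 → R3) (c : Fin 3 → Fin 3 → Fin 3 → R3 → ℝ)
    (g : Fin 3 → R3 → ℝ) (ξ : R3 → ℝ)
    (hD : IsFrame D) (hc : IsStructFns D c) (hgξ : SmoothDatum g ξ)
    (hcon : BKLConstraints D c g ξ)
    (u : R3 → ℝ) (hnf : IsNormalForm c g u)
    (hu : ∀ x : R3, 1 < u x ∧ u x ≠ 2) :
    IsFrame ![fun x : R3 => (u x / (u x - 1)) • D 2 x,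
      fun x : R3 => (u x / (u x - 1)) • D 1 x,
      fun x : R3 => (u x / (u x - 1)) • tiltedD1 D c ξ u x] ∧
    SmoothDatum ![fun _ : R3 => (1 / 2 : ℝ),
      fun x : R3 => -(1 + (u x - 1)) / 2,
      fun x : R3 => -(1 + 1 / (u x - 1)) / 2]
      (fun x : R3 => ξ x + Real.log (u x / (u x - 1))) ∧
    ∀ chat : Fin 3 → Fin 3 → Fin 3 → R3 → ℝ,
      IsStructFns ![fun x : R3 => (u x / (u x - 1)) • D 2 x,
        fun x : R3 => (u x / (u x - 1)) • D 1 x,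
        fun x : R3 => (u x / (u x - 1)) • tiltedD1 D c ξ u x] chat →
      BKLConstraints ![fun x : R3 => (u x / (u x - 1)) • D 2 x,
        fun x : R3 => (u x / (u x - 1)) • D 1 x,
        fun x : R3 => (u x / (u x - 1)) • tiltedD1 D c ξ u x] chat
        ![fun _ : R3 => (1 / 2 : ℝ),
          fun x : R3 => -(1 + (u x - 1)) / 2,
          fun x : R3 => -(1 + 1 / (u x - 1)) / 2]
        (fun x : R3 => ξ x + Real.log (u x / (u x - 1))) := by
  
  obtain ⟨hus, -, hg0, hg1, hg2, hc120⟩ := hnf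
  have hu0 : ∀ x, u x ≠ 0 := fun x => by linarith [(hu x).1]
  have hu1 : ∀ x, u x - 1 ≠ 0 := fun x => by linarith [(hu x).1]
  have hu2 : ∀ x, u x - 2 ≠ 0 := fun x => sub_ne_zero.2 (hu x).2
  have hu3 : ∀ x, 2 * u x - 1 ≠ 0 := fun x => by linarith [(hu x).1]
  have hξ := hgξ.2
  have hl : ContDiff ℝ (⊤ : ℕ∞) fun x => u x / (u x - 1) := hus.div (hus.sub contDiff_const) hu1
  have hl0 : ∀ x, u x / (u x - 1) ≠ 0 := fun x => div_ne_zero (hu0 x) (hu1 x)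
  have hG2 : ContDiff ℝ (⊤ : ℕ∞) (g23fn D c ξ) := (hc.1 0 1 0).neg.sub ((hD.1 1).dirD hξ)
  have hG3 : ContDiff ℝ (⊤ : ℕ∞) (g34fn D c ξ) := (hc.1 2 0 0).neg.add ((hD.1 2).dirD hξ)
  obtain ⟨a, ha⟩ : ∃ a : R3 → ℝ, a = fun x => -(2 * g34fn D c ξ x / (u x - 2)) := ⟨_, rfl⟩
  obtain ⟨b, hb⟩ : ∃ b : R3 → ℝ, b = fun x => 2 * u x * g23fn D c ξ x / (2 * u x - 1) := ⟨_, rfl⟩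
  have has : ContDiff ℝ (⊤ : ℕ∞) a := by
    rw [ha]
    exact ((contDiff_const.mul hG3).div (hus.sub contDiff_const) hu2).neg
  have hbs : ContDiff ℝ (⊤ : ℕ∞) b := by
    rw [hb]
    exact ((contDiff_const.mul hus).mul hG2).div ((contDiff_const.mul hus).sub contDiff_const) hu3
  have hT : tiltedD1 D c ξ u = fun x => D 0 x + a x • D 1 x + b x • D 2 x := by
    funext x
    simp only [tiltedD1, ha, hb]
    module
  have hE := hD.tilt has hbs
  have hEl : (![fun x : R3 => (u x / (u x - 1)) • D 2 x, fun x : R3 => (u x / (u x - 1)) • D 1 x,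
      fun x : R3 => (u x / (u x - 1)) • tiltedD1 D c ξ u x] : Fin 3 → R3 → R3) =
      fun i x => (u x / (u x - 1)) •
        (![D 2, D 1, fun x => D 0 x + a x • D 1 x + b x • D 2 x] : Fin 3 → R3 → R3) i x := by
    funext i
    fin_cases i <;> simp [hT]
  have hEh := hE.smul hl hl0
  rw [hEl]
  refine ⟨hEh, ⟨fun i => ?_, ?_⟩, fun chat hch => ⟨fun x => ?_, fun i j k hijk x => ?_⟩⟩
  · fin_cases i
    · exact contDiff_const
    · exact (contDiff_const.add (hus.sub contDiff_const)).neg.div_const 2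
    · exact (contDiff_const.add (contDiff_const.div (hus.sub contDiff_const) hu1)).neg.div_const 2
  · exact hξ.add (hl.log hl0)
  · have := hu1 x
    simp only [Matrix.cons_val]
    field_simp
    ring
  -- the structure functions of the new frame
  have hfs : ∀ i, ContDiff ℝ (⊤ : ℕ∞) ((![fun _ => 1, a, b] : Fin 3 → R3 → ℝ) i) := fun i => by
    fin_cases i
    exacts [contDiff_const, has, hbs]
  have hTs : (fun x => D 0 x + a x • D 1 x + b x • D 2 x) =
      fun x => ∑ i, (![fun _ => 1, a, b] : Fin 3 → R3 → ℝ) i x • D i x := by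
    funext x
    simp [Fin.sum_univ_three]
  have e01 := (hc.2 2 1 x).trans (sum_smul_tilt D a b (fun i => c 2 1 i x) x)
  have e02 := (hc.lieB_sum_smul hD hfs 2 x).trans (sum_smul_tilt D a b _ x)
  have e12 := (hc.lieB_sum_smul hD hfs 1 x).trans (sum_smul_tilt D a b _ x)
  rw [← hTs] at e02 e12
  have k01 := hch.smul_eq hE hl (hl0 x) (j := 0) (k := 1) e01
  have k02 := hch.smul_eq hE hl (hl0 x) (j := 0) (k := 2) e02
  have k12 := hch.smul_eq hE hl (hl0 x) (j := 1) (k := 2) e12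
  have k011 := k01 1
  have k022 := k02 2
  have k122 := k12 2
  have k100 := (hch.swap hEh 1 0 0 x).trans (congrArg Neg.neg (k01 0))
  have k200 := (hch.swap hEh 2 0 0 x).trans (congrArg Neg.neg (k02 0))
  have k211 := (hch.swap hEh 2 1 1 x).trans (congrArg Neg.neg (k12 1))
  -- antisymmetry of the old structure functions
  have s210 : c 2 1 0 x = 2 := by rw [hc.swap hD, hc120]; norm_num
  have s211 := hc.swap hD 2 1 1 x
  have s212 := hc.swap hD 2 1 2 x
  have s100 := hc.swap hD 1 0 0 x
  have s101 := hc.swap hD 1 0 1 x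
  have s102 := hc.swap hD 1 0 2 x
  have s022 := hc.swap hD 0 2 2 x
  have s020 := hc.swap hD 0 2 0 x
  -- derivatives of functions of `u`
  have d12 : ∀ X, dirD X (fun y => g 1 y + g 2 y) x =
      (-1 / 2 + 1 / (2 * u x ^ 2)) * dirD X u x := fun X => by
    simp only [hg1, hg2]
    refine dirD_comp X hus (φ := fun t => -(1 + t) / 2 + -(1 + 1 / t) / 2) ?_
    have h := (((hasDerivAt_id (u x)).const_add 1).neg.div_const 2).add
      ((((hasDerivAt_inv (hu0 x)).const_add 1).neg.div_const 2))
    simp only [one_div]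
    refine h.congr_deriv ?_
    field_simp
  have d20 : ∀ X, dirD X (fun y => g 2 y + g 0 y) x =
      1 / (2 * u x ^ 2) * dirD X u x := fun X => by
    simp only [hg0, hg2]
    refine dirD_comp X hus (φ := fun t => -(1 + 1 / t) / 2 + 1 / 2) ?_
    have h := ((((hasDerivAt_inv (hu0 x)).const_add 1).neg.div_const 2)).add_const (1 / 2)
    simp only [one_div] at h ⊢
    refine h.congr_deriv ?_
    field_simp
  have d01 : ∀ X, dirD X (fun y => g 0 y + g 1 y) x = -1 / 2 * dirD X u x := fun X => by
    simp only [hg0, hg1]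
    refine dirD_comp X hus (φ := fun t => 1 / 2 + -(1 + t) / 2) ?_
    exact (((hasDerivAt_id (u x)).const_add 1).neg.div_const 2).const_add _
  have dl : ∀ X, dirD X (fun y => u y / (u y - 1)) x = -1 / (u x - 1) ^ 2 * dirD X u x :=
      fun X => by
    refine dirD_comp X hus (φ := fun t => t / (t - 1)) ?_
    have h := (hasDerivAt_id (u x)).div ((hasDerivAt_id (u x)).sub_const 1) (hu1 x)
    refine h.congr_deriv ?_
    simp
  have dξ : ∀ X, dirD X (fun y => ξ y + Real.log (u y / (u y - 1))) x =
      dirD X ξ x + (1 / u x - 1 / (u x - 1)) * dirD X u x := fun X => by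
    have h := hu1 x
    have h' := hu0 x
    rw [dirD_add X hξ (hl.log hl0), dirD_comp X hl (Real.hasDerivAt_log (hl0 x)), dl]
    field_simp
    ring
  have dh12 : ∀ X, dirD X (fun y => -(1 + (u y - 1)) / 2 + -(1 + 1 / (u y - 1)) / 2) x =
      (-1 / 2 + 1 / (2 * (u x - 1) ^ 2)) * dirD X u x := fun X => by
    refine dirD_comp X hus (φ := fun t => -(1 + (t - 1)) / 2 + -(1 + 1 / (t - 1)) / 2) ?_
    have h0 := (hasDerivAt_id (u x)).sub_const 1
    have h := ((h0.const_add 1).neg.div_const 2).add (((h0.inv (hu1 x)).const_add 1).neg.div_const 2)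
    have := hu1 x
    simp only [one_div]
    refine h.congr_deriv ?_
    simp only [id]
    field_simp
  have dh20 : ∀ X, dirD X (fun y => -(1 + 1 / (u y - 1)) / 2 + 1 / 2) x =
      1 / (2 * (u x - 1) ^ 2) * dirD X u x := fun X => by
    refine dirD_comp X hus (φ := fun t => -(1 + 1 / (t - 1)) / 2 + 1 / 2) ?_
    have h0 := (hasDerivAt_id (u x)).sub_const 1
    have h := (((h0.inv (hu1 x)).const_add 1).neg.div_const 2).add_const (1 / 2)
    have := hu1 x
    simp only [one_div] at h ⊢
    refine h.congr_deriv ?_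
    simp only [id]
    field_simp
  have dh01 : ∀ X, dirD X (fun y => 1 / 2 + -(1 + (u y - 1)) / 2) x = -1 / 2 * dirD X u x :=
      fun X => by
    refine dirD_comp X hus (φ := fun t => 1 / 2 + -(1 + (t - 1)) / 2) ?_
    exact ((((hasDerivAt_id (u x)).sub_const 1).const_add 1).neg.div_const 2).const_add _
  -- derivatives of `a` and `b`
  have da : ∀ X, dirD X a x * (u x - 2) + a x * dirD X u x = -2 * dirD X (g34fn D c ξ) x :=
      fun X => by
    have h : (fun y => a y * (u y + -2)) = fun y => -2 * g34fn D c ξ y := by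
      funext y
      have := hu2 y
      simp only [ha]
      field_simp
      ring
    have h' := congrFun (congrArg (dirD X) h) x
    rw [dirD_mul X has (hus.add contDiff_const), dirD_mul X contDiff_const hG3,
      dirD_add X hus contDiff_const] at h'
    simp only [dirD_const] at h'
    linear_combination h'
  have db : ∀ X, dirD X b x * (2 * u x - 1) + 2 * b x * dirD X u x =
      2 * dirD X u x * g23fn D c ξ x + 2 * u x * dirD X (g23fn D c ξ) x := fun X => by
    have h : (fun y => b y * (2 * u y + -1)) = fun y => 2 * (u y * g23fn D c ξ y) := by
      funext y
      have := hu3 y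
      simp only [hb]
      field_simp
      ring
    have h' := congrFun (congrArg (dirD X) h) x
    rw [dirD_mul X hbs ((contDiff_const.mul hus).add contDiff_const),
      dirD_mul X contDiff_const (hus.mul hG2), dirD_mul X hus hG2,
      dirD_add X (contDiff_const.mul hus) contDiff_const, dirD_mul X contDiff_const hus] at h'
    simp only [dirD_const] at h'
    linear_combination h'
  have dG3 : ∀ X, dirD X (g34fn D c ξ) x =
      -dirD X (c 2 0 0) x + dirD X (dirD (D 2) ξ) x := fun X => by
    unfold g34fn
    rw [dirD_add X (hc.1 2 0 0).neg ((hD.1 2).dirD hξ), dirD_neg]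
  have dG2 : ∀ X, dirD X (g23fn D c ξ) x =
      -dirD X (c 0 1 0) x - dirD X (dirD (D 1) ξ) x := fun X => by
    unfold g23fn
    simp only [sub_eq_add_neg]
    rw [dirD_add X (hc.1 0 1 0).neg ((hD.1 1).dirD hξ).neg, dirD_neg, dirD_neg]
  have jac := hc.jacobi hD 2 0 1 0 x
  have comm := hc.dirD_comm hD hξ 1 2 x
  have dc : dirD (D 0) (c 2 1 0) x = 0 := by
    rw [show c 2 1 0 = fun _ => 2 from funext fun y => by rw [hc.swap hD, hc120]; norm_num,
      dirD_const]
  have s00 := hc.self hD 0 0 x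
  have s11 := hc.self hD 1
  have s22 := hc.self hD 2
  have h0 := hcon.2 0 1 2 (by simp [Cyclic]) x
  have h1 := hcon.2 1 2 0 (by simp [Cyclic]) x
  have h2 := hcon.2 2 0 1 (by simp [Cyclic]) x
  have da1 := da (D 1)
  have db2 := db (D 2)
  have ax : a x = -(2 * g34fn D c ξ x / (u x - 2)) := congrFun ha x
  have bx : b x = 2 * u x * g23fn D c ξ x / (2 * u x - 1) := congrFun hb x
  have G2x : g23fn D c ξ x = -c 0 1 0 x - dirD (D 1) ξ x := rfl
  have G3x : g34fn D c ξ x = -c 2 0 0 x + dirD (D 2) ξ x := rfl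
  rw [d12, hg0, hg1, hg2] at h0
  rw [d20, hg0, hg1, hg2] at h1
  rw [d01, hg0, hg1, hg2] at h2
  rw [dG3] at da1
  rw [dG2] at db2
  simp only [Fin.sum_univ_three, Matrix.cons_val, dirD_const, dl, s00, s11, s22, s210, s211, s212,
    s100, s101, s102, s020, s022, hc120, dc, Fin.reduceEq, if_true, if_false]
    at k011 k022 k122 k100 k200 k211 jac comm h0 h1 h2
  have t1 := hu1 x
  have t0 := hu0 x
  have t2 := hu2 x
  have t3 := hu3 x
  rw [← eq_sub_iff_add_eq, ← eq_div_iff t2, ax, G3x] at da1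
  rw [← eq_sub_iff_add_eq, ← eq_div_iff t3, bx, G2x] at db2
  rw [G3x] at ax
  rw [G2x] at bx
  rcases hijk with h | h | h <;> obtain ⟨rfl, rfl, rfl⟩ := by simpa using h
  · simp only [Matrix.cons_val, dirD_smul, dh12, dξ, k011, k022, ax]
    linear_combination (norm := (field_simp; ring)) (u x / (u x - 1)) ^ 2 * h2
  · simp only [Matrix.cons_val, dirD_smul, dh20, dξ, k122, k100, bx]
    linear_combination (norm := (field_simp; ring)) (u x / (u x - 1)) ^ 2 * h1
  · simp only [Matrix.cons_val, dirD_smul, dirD_field_smul_add, dh01, dξ, k200, k211, da1, db2,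
      ax, bx]
    linear_combination (norm := (field_simp; ring)) (u x / (u x - 1)) ^ 2 *
      (h0 + (-(2 * (-c 2 0 0 x + dirD (D 2) ξ x) / (u x - 2))) * h1 +
        2 * u x * (-c 0 1 0 x - dirD (D 1) ξ x) / (2 * u x - 1) * h2 + comm - jac)
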